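/- Let p > 1 and let μ ∈ P_p([0,∞)) be supported on the compact interval [0, M] for some M > 0. Then the Wasserstein projection proj_{F_{m,p}}^{(p)} μ is supported on the interval [0, 2M]. In particular, if μ is compactly supported then so is proj_{F_{m,p}}^{(p)} μ. -/

import Mathlib

open MeasureTheory Set Filter

noncomputable def quantile (μ : MeasureTheory.Measure ℝ) (u : ℝ) : ℝ :=
  sInf {x : ℝ | u ≤ (μ (Set.Iic x)).toReal}

def HasFiniteMomentP (p : ℝ) (μ : MeasureTheory.Measure ℝ) : Prop :=
  MeasureTheory.IsProbabilityMeasure μ ∧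
    MeasureTheory.Integrable (fun x => |x| ^ p) μ

noncomputable def Wdist (p : ℝ) (μ ν : MeasureTheory.Measure ℝ) : ℝ :=
  (∫ u in Set.Ioo (0:ℝ) 1, |quantile μ u - quantile ν u| ^ p) ^ (1 / p)

def DisplacementConvex (F : Set (MeasureTheory.Measure ℝ)) : Prop :=
  ∀ μ ∈ F, ∀ ν ∈ F, ∀ t ∈ Set.Icc (0:ℝ) 1, ∃ σ ∈ F,
    ∀ u ∈ Set.Ioo (0:ℝ) 1,
      quantile σ u = (1 - t) * quantile μ u + t * quantile ν u

def WClosed (p : ℝ) (F : Set (MeasureTheory.Measure ℝ)) : Prop :=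
  ∀ (μs : ℕ → MeasureTheory.Measure ℝ) (μ : MeasureTheory.Measure ℝ),
    (∀ n, μs n ∈ F) → HasFiniteMomentP p μ →
    Filter.Tendsto (fun n => Wdist p (μs n) μ) Filter.atTop (nhds 0) → μ ∈ F

/-- The model `F_{m,p}`: probability measures on `[0,∞)` with finite `p`-th moment whose
quantile function is convex, non-decreasing, and tends to `0` as `u ↓ 0`. -/
def Fmp (p : ℝ) : Set (MeasureTheory.Measure ℝ) :=
  {μ | HasFiniteMomentP p μ ∧ μ (Set.Iio (0:ℝ)) = 0 ∧
    ConvexOn ℝ (Set.Ioo (0:ℝ) 1) (quantile μ) ∧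
    MonotoneOn (quantile μ) (Set.Ioo (0:ℝ) 1) ∧
    Filter.Tendsto (quantile μ) (nhdsWithin 0 (Set.Ioi 0)) (nhds 0)}

theorem quantile_le_iff (μ : Measure ℝ) [IsProbabilityMeasure μ] {u : ℝ} (hu : u ∈ Ioo (0:ℝ) 1)
    (x : ℝ) : quantile μ u ≤ x ↔ u ≤ (μ (Iic x)).toReal := by
  have hF : ∀ y, (μ (Iic y)).toReal = ProbabilityTheory.cdf μ y := fun y => by
    rw [ProbabilityTheory.cdf_eq_real, measureReal_def]
  simp only [quantile, hF]
  obtain ⟨a, ha⟩ := ((ProbabilityTheory.tendsto_cdf_atBot μ).eventually_lt_const hu.1).exists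
  obtain ⟨b, hb⟩ := ((ProbabilityTheory.tendsto_cdf_atTop μ).eventually_const_lt hu.2).exists
  have hbdd : BddBelow {x | u ≤ ProbabilityTheory.cdf μ x} := by
    refine ⟨a, fun y hy => ?_⟩
    by_contra! h
    exact absurd (ProbabilityTheory.monotone_cdf μ h.le) (not_le.2 (ha.trans_le hy))
  refine ⟨fun h => ?_, fun h => csInf_le hbdd h⟩
  have hright : Tendsto (ProbabilityTheory.cdf μ) (nhdsWithin x (Ioi x))
      (nhds (ProbabilityTheory.cdf μ x)) :=
    ((ProbabilityTheory.cdf μ).right_continuous x).tendsto.mono_left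
      (nhdsWithin_mono _ Ioi_subset_Ici_self)
  refine ge_of_tendsto hright (eventually_nhdsWithin_of_forall fun y hy => ?_)
  obtain ⟨z, hz, hzy⟩ := exists_lt_of_csInf_lt ⟨b, hb.le⟩ (h.trans_lt hy)
  exact le_trans hz (ProbabilityTheory.monotone_cdf μ hzy.le)

theorem quantile_monotoneOn (μ : Measure ℝ) [IsProbabilityMeasure μ] :
    MonotoneOn (quantile μ) (Ioo (0:ℝ) 1) := fun _ hu _ hv huv =>
  (quantile_le_iff μ hu _).2 (huv.trans ((quantile_le_iff μ hv _).1 le_rfl))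

theorem aemeasurable_quantile (μ : Measure ℝ) [IsProbabilityMeasure μ] :
    AEMeasurable (quantile μ) (volume.restrict (Ioo (0:ℝ) 1)) :=
  aemeasurable_restrict_of_monotoneOn measurableSet_Ioo (quantile_monotoneOn μ)

instance isProbabilityMeasure_restrict_Ioo_zero_one :
    IsProbabilityMeasure ((volume : Measure ℝ).restrict (Ioo (0:ℝ) 1)) := ⟨by simp⟩

theorem map_quantile (μ : Measure ℝ) [IsProbabilityMeasure μ] :
    (volume.restrict (Ioo (0:ℝ) 1)).map (quantile μ) = μ := by
  have hm := aemeasurable_quantile μ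
  have := Measure.isProbabilityMeasure_map hm
  refine Measure.ext_of_Iic _ _ fun x => ?_
  rw [Measure.map_apply_of_aemeasurable hm measurableSet_Iic]
  have hle : (μ (Iic x)).toReal ≤ 1 := by
    simpa [measureReal_def] using (measureReal_le_one : μ.real (Iic x) ≤ 1)
  have hset : (quantile μ ⁻¹' Iic x) ∩ Ioo (0:ℝ) 1
      = Ioc 0 (μ (Iic x)).toReal ∩ Iio 1 := by
    ext u
    simp only [mem_inter_iff, mem_preimage, mem_Iic, mem_Ioo, mem_Ioc, mem_Iio]
    constructor
    · rintro ⟨h, hu⟩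
      exact ⟨⟨hu.1, (quantile_le_iff μ hu x).1 h⟩, hu.2⟩
    · rintro ⟨⟨h0, h⟩, h1⟩
      exact ⟨(quantile_le_iff μ ⟨h0, h1⟩ x).2 h, h0, h1⟩
  rw [Measure.restrict_apply' measurableSet_Ioo, hset]
  apply le_antisymm
  · refine (measure_mono inter_subset_left).trans ?_
    rw [Real.volume_Ioc, sub_zero, ENNReal.ofReal_toReal (measure_ne_top _ _)]
  · have : Ioo 0 (μ (Iic x)).toReal ⊆ Ioc 0 (μ (Iic x)).toReal ∩ Iio 1 :=
      fun u hu => ⟨⟨hu.1, hu.2.le⟩, hu.2.trans_le hle⟩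
    refine le_trans ?_ (measure_mono this)
    rw [Real.volume_Ioo, sub_zero, ENNReal.ofReal_toReal (measure_ne_top _ _)]

/-- A continuous non-decreasing function on `(0,1)` is the quantile function of the
pushforward of Lebesgue measure. -/
theorem quantile_map_of_monotoneOn {G : ℝ → ℝ} (hG : MonotoneOn G (Ioo (0:ℝ) 1))
    (hc : ContinuousOn G (Ioo (0:ℝ) 1)) {u : ℝ} (hu : u ∈ Ioo (0:ℝ) 1) :
    quantile ((volume.restrict (Ioo (0:ℝ) 1)).map G) u = G u := by
  have hm : AEMeasurable G (volume.restrict (Ioo (0:ℝ) 1)) :=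
    aemeasurable_restrict_of_monotoneOn measurableSet_Ioo hG
  have := Measure.isProbabilityMeasure_map hm
  refine eq_of_forall_ge_iff fun x => ?_
  rw [quantile_le_iff _ hu, Measure.map_apply_of_aemeasurable hm measurableSet_Iic,
    Measure.restrict_apply' measurableSet_Ioo]
  constructor
  · intro h
    by_contra! hx
    have hev := (hc.continuousAt (isOpen_Ioo.mem_nhds hu)).eventually_const_lt hx
    obtain ⟨w, ⟨hw0, hwu⟩, hw⟩ := ((show ∀ᶠ w in nhdsWithin u (Iio u), w ∈ Ioo 0 u from
      Ioo_mem_nhdsLT hu.1).and (hev.filter_mono nhdsWithin_le_nhds)).exists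
    have hsub : (G ⁻¹' Iic x) ∩ Ioo (0:ℝ) 1 ⊆ Ioo 0 w := by
      rintro v ⟨hv, hv01⟩
      refine ⟨hv01.1, ?_⟩
      by_contra! hwv
      exact absurd (hG ⟨hw0, hwu.trans hu.2⟩ hv01 hwv) (not_le.2 (lt_of_le_of_lt hv hw))
    have := ENNReal.toReal_mono (by simp) (measure_mono (μ := volume) hsub)
    rw [Real.volume_Ioo, sub_zero, ENNReal.toReal_ofReal hw0.le] at this
    linarith
  · intro h
    have hsub : Ioc 0 u ⊆ (G ⁻¹' Iic x) ∩ Ioo (0:ℝ) 1 := fun v hv =>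
      ⟨(hG ⟨hv.1, hv.2.trans_lt hu.2⟩ hu hv.2).trans h, hv.1, hv.2.trans_lt hu.2⟩
    have hfin : volume ((G ⁻¹' Iic x) ∩ Ioo (0:ℝ) 1) ≠ ⊤ :=
      ((measure_mono inter_subset_right).trans_lt (by simp)).ne
    have := ENNReal.toReal_mono hfin (measure_mono (μ := volume) hsub)
    rwa [Real.volume_Ioc, sub_zero, ENNReal.toReal_ofReal hu.1.le] at this

theorem integrableOn_quantile_rpow {p : ℝ} {μ : Measure ℝ} (hμ : HasFiniteMomentP p μ) :
    IntegrableOn (fun u => |quantile μ u| ^ p) (Ioo (0:ℝ) 1) := by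
  have := hμ.1
  have h := hμ.2
  rw [← map_quantile μ] at h
  exact (integrable_map_measure h.aestronglyMeasurable (aemeasurable_quantile μ)).1 h

theorem quantile_mem_Icc {μ : Measure ℝ} [IsProbabilityMeasure μ] {M : ℝ}
    (h : μ (Icc (0:ℝ) M)ᶜ = 0) {u : ℝ} (hu : u ∈ Ioo (0:ℝ) 1) : quantile μ u ∈ Icc 0 M := by
  constructor
  · by_contra! hneg
    have h1 := (quantile_le_iff μ hu _).1 (le_refl (quantile μ u))
    have h2 : μ (Iic (quantile μ u)) = 0 :=
      measure_mono_null (show Iic (quantile μ u) ⊆ (Icc (0:ℝ) M)ᶜ from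
        fun x hx hx' => absurd hx'.1 (not_le.2 (lt_of_le_of_lt hx hneg))) h
    rw [h2] at h1
    exact absurd h1 (not_le.2 hu.1)
  · refine (quantile_le_iff μ hu M).2 ?_
    have h2 : μ (Iic M)ᶜ = 0 := measure_mono_null
      (compl_subset_compl.2 Icc_subset_Iic_self) h
    rw [(prob_compl_eq_zero_iff measurableSet_Iic).1 h2]
    exact hu.2.le

theorem exists_mem_Fmp_quantile_eq {p : ℝ} (hp : 0 < p) {G : ℝ → ℝ}
    (hconv : ConvexOn ℝ (Ioo (0:ℝ) 1) G) (hmono : MonotoneOn G (Ioo (0:ℝ) 1))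
    (hnonneg : ∀ u ∈ Ioo (0:ℝ) 1, 0 ≤ G u)
    (hzero : Tendsto G (nhdsWithin 0 (Ioi 0)) (nhds 0))
    (hint : IntegrableOn (fun u => |G u| ^ p) (Ioo (0:ℝ) 1)) :
    ∃ ν ∈ Fmp p, ∀ u ∈ Ioo (0:ℝ) 1, quantile ν u = G u := by
  have hm : AEMeasurable G (volume.restrict (Ioo (0:ℝ) 1)) :=
    aemeasurable_restrict_of_monotoneOn measurableSet_Ioo hmono
  have hq : EqOn G (quantile ((volume.restrict (Ioo (0:ℝ) 1)).map G)) (Ioo (0:ℝ) 1) :=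
    fun u hu => (quantile_map_of_monotoneOn hmono (hconv.continuousOn isOpen_Ioo) hu).symm
  refine ⟨_, ⟨⟨Measure.isProbabilityMeasure_map hm, ?_⟩, ?_, hconv.congr hq, hmono.congr hq, ?_⟩,
    fun u hu => (hq hu).symm⟩
  · refine (integrable_map_measure ?_ hm).2 hint
    exact (continuous_abs.rpow_const fun _ => Or.inr hp.le).aestronglyMeasurable
  · rw [Measure.map_apply_of_aemeasurable hm measurableSet_Iio,
      Measure.restrict_apply' measurableSet_Ioo]
    convert measure_empty (μ := (volume : Measure ℝ))
    ext u
    simpa using fun h h0 => not_lt.1 fun h1 => absurd (hnonneg u ⟨h0, h1⟩) (not_le.2 h)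
  · exact hzero.congr' ((hq.eventuallyEq_of_mem (Ioo_mem_nhdsGT one_pos)))

theorem convexOn_abs_rpow {p : ℝ} (hp : 1 ≤ p) : ConvexOn ℝ univ fun x : ℝ => |x| ^ p := by
  refine ⟨convex_univ, fun x _ y _ a b ha hb hab => ?_⟩
  have h := (convexOn_rpow hp).2 (abs_nonneg x : |x| ∈ Ici 0) (abs_nonneg y : |y| ∈ Ici 0) ha hb hab
  refine le_trans (Real.rpow_le_rpow (abs_nonneg _) ?_ (by linarith)) h
  simpa [abs_mul, abs_of_nonneg ha, abs_of_nonneg hb] using abs_add_le (a * x) (b * y)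

theorem deriv_abs_rpow {p : ℝ} (hp : 1 < p) (x : ℝ) :
    deriv (fun x : ℝ => |x| ^ p) x = p * |x| ^ (p - 2) * x :=
  (hasDerivAt_abs_rpow x hp).deriv

theorem abs_deriv_abs_rpow {p : ℝ} (hp : 1 < p) (x : ℝ) :
    |deriv (fun x : ℝ => |x| ^ p) x| = p * |x| ^ (p - 1) := by
  rw [deriv_abs_rpow hp, abs_mul, abs_of_nonneg (by positivity), mul_assoc]
  congr 1
  rcases eq_or_ne x 0 with rfl | hx
  · simp [Real.zero_rpow (sub_pos.2 hp).ne']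
  · rw [← Real.rpow_add_one (abs_ne_zero.2 hx)]
    congr 1
    ring

theorem monotone_deriv_abs_rpow {p : ℝ} (hp : 1 < p) :
    Monotone (deriv fun x : ℝ => |x| ^ p) :=
  monotoneOn_univ.1 <| (convexOn_abs_rpow hp.le).monotoneOn_deriv
    fun x _ => (hasDerivAt_abs_rpow x hp).differentiableAt

theorem continuous_deriv_abs_rpow {p : ℝ} (hp : 1 < p) :
    Continuous (deriv fun x : ℝ => |x| ^ p) :=
  (contDiff_norm_rpow (E := ℝ) hp).continuous_deriv le_rfl

theorem deriv_abs_rpow_neg {p : ℝ} (hp : 1 < p) (x : ℝ) :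
    deriv (fun x : ℝ => |x| ^ p) (-x) = -deriv (fun x : ℝ => |x| ^ p) x := by
  simp [deriv_abs_rpow hp]

theorem deriv_abs_rpow_nonneg {p : ℝ} (hp : 1 < p) {x : ℝ} (hx : 0 ≤ x) :
    0 ≤ deriv (fun x : ℝ => |x| ^ p) x := by
  rw [deriv_abs_rpow hp]
  positivity

theorem deriv_abs_rpow_lt {p : ℝ} (hp : 1 < p) {x y : ℝ} (hx : 0 ≤ x) (hxy : x < y) :
    deriv (fun x : ℝ => |x| ^ p) x < deriv (fun x : ℝ => |x| ^ p) y := by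
  rw [← abs_of_nonneg (deriv_abs_rpow_nonneg hp hx),
    ← abs_of_nonneg (deriv_abs_rpow_nonneg hp (hx.trans hxy.le)),
    abs_deriv_abs_rpow hp, abs_deriv_abs_rpow hp, abs_of_nonneg hx,
    abs_of_nonneg (hx.trans hxy.le)]
  have := Real.rpow_lt_rpow hx hxy (sub_pos.2 hp)
  have : 0 < p := by linarith
  gcongr

theorem abs_rpow_add_deriv_mul_le {p : ℝ} (hp : 1 < p) (x y : ℝ) :
    |y| ^ p + deriv (fun x : ℝ => |x| ^ p) y * (x - y) ≤ |x| ^ p := by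
  have hd := (hasDerivAt_abs_rpow y hp).differentiableAt
  rcases lt_trichotomy x y with h | rfl | h
  · have := (convexOn_abs_rpow hp.le).slope_le_deriv (mem_univ x) (mem_univ y) h hd
    rw [slope_def_field, div_le_iff₀ (by linarith)] at this
    linarith
  · simp
  · have := (convexOn_abs_rpow hp.le).deriv_le_slope (mem_univ y) (mem_univ x) h hd
    rw [slope_def_field, le_div_iff₀ (by linarith)] at this
    linarith

/-- Subgradient inequality for a convex function on `(0,1)`. -/
theorem ConvexOn.exists_add_mul_le {Q : ℝ → ℝ} (hQ : ConvexOn ℝ (Ioo (0:ℝ) 1) Q) {c : ℝ}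
    (hc : c ∈ Ioo (0:ℝ) 1) : ∃ s, ∀ x ∈ Ioo (0:ℝ) 1, Q c + s * (x - c) ≤ Q x := by
  have hci : c ∈ interior (Ioo (0:ℝ) 1) := by rwa [isOpen_Ioo.interior_eq]
  refine ⟨derivWithin Q (Ioi c) c, fun x hx => ?_⟩
  rcases lt_trichotomy x c with h | rfl | h
  · have h1 := (hQ.slope_le_leftDeriv_of_mem_interior hx hci h).trans
      (hQ.leftDeriv_le_rightDeriv_of_mem_interior hci)
    rw [slope_def_field, div_le_iff₀ (by linarith)] at h1
    linarith
  · simp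
  · have h1 := hQ.rightDeriv_le_slope_of_mem_interior hci hx h
    rw [slope_def_field, le_div_iff₀ (by linarith)] at h1
    linarith

/-- Replacing a convex function beyond `c` by a supporting line at `c` preserves convexity. -/
theorem ConvexOn.piecewise_supporting_line {Q : ℝ → ℝ} (hQ : ConvexOn ℝ (Ioo (0:ℝ) 1) Q) {c s : ℝ}
    (hc : c ∈ Ioo (0:ℝ) 1) (hs : ∀ x ∈ Ioo (0:ℝ) 1, Q c + s * (x - c) ≤ Q x) :
    ConvexOn ℝ (Ioo (0:ℝ) 1) fun x => if x ≤ c then Q x else Q c + s * (x - c) := by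
  refine convexOn_of_slope_mono_adjacent (convex_Ioo _ _) fun {x y z} hx hz hxy hyz => ?_
  have hy : y ∈ Ioo (0:ℝ) 1 := ⟨hx.1.trans hxy, hyz.trans hz.2⟩
  have hxy' : 0 < y - x := sub_pos.2 hxy
  have hyz' : 0 < z - y := sub_pos.2 hyz
  rcases le_or_gt z c with hzc | hzc
  · have hyc := hyz.le.trans hzc
    simpa [hzc, hyc, hxy.le.trans hyc] using hQ.slope_mono_adjacent hx hz hxy hyz
  rw [if_neg hzc.not_ge]
  rcases le_or_gt y c with hyc | hyc
  · rw [if_pos hyc, if_pos (hxy.le.trans hyc)]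
    set k := (Q y - Q x) / (y - x) with hk
    have hkc : k * (c - y) ≤ Q c - Q y := by
      rcases hyc.lt_or_eq with h | rfl
      · have := hQ.slope_mono_adjacent hx hc hxy h
        rwa [← hk, le_div_iff₀ (by linarith)] at this
      · simp
    have hks : k ≤ s := by
      have h1 := hs x hx
      have h2 : k * (y - x) = Q y - Q x := div_mul_cancel₀ _ hxy'.ne'
      have : k * (c - x) ≤ s * (c - x) := by linarith
      exact le_of_mul_le_mul_right this (by linarith)
    rw [le_div_iff₀ hyz']
    nlinarith [mul_le_mul_of_nonneg_right hks (sub_nonneg.2 hzc.le)]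
  · rw [if_neg hyc.not_ge]
    have hright : (Q c + s * (z - c) - (Q c + s * (y - c))) / (z - y) = s := by
      field_simp
      ring
    rw [hright, div_le_iff₀ hxy']
    split_ifs with hxc
    · have := hs x hx
      linarith
    · linarith

/-- A non-negative convex non-decreasing function on `(0,1)` admits a non-negative non-decreasing
perturbation `φ`, vanishing up to `c`, whose removal keeps it convex and non-decreasing, and which
vanishes beyond `c` only where `Q` vanishes or is affine. -/
theorem exists_hinge_perturbation {Q : ℝ → ℝ} (hconv : ConvexOn ℝ (Ioo (0:ℝ) 1) Q)
    (hmono : MonotoneOn Q (Ioo (0:ℝ) 1)) (hnonneg : ∀ u ∈ Ioo (0:ℝ) 1, 0 ≤ Q u)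
    {c : ℝ} (hc : c < 1) :
    ∃ φ : ℝ → ℝ, (∀ u ∈ Ioo (0:ℝ) 1, 0 ≤ φ u ∧ φ u ≤ Q u) ∧ MonotoneOn φ (Ioo (0:ℝ) 1) ∧
      ConvexOn ℝ (Ioo (0:ℝ) 1) (Q - φ) ∧ MonotoneOn (Q - φ) (Ioo (0:ℝ) 1) ∧
      (∀ u ∈ Ioo (0:ℝ) 1, u ≤ c → φ u = 0) ∧
      ∀ u ∈ Ioo (0:ℝ) 1, φ u = 0 → Q u = 0 ∨
        0 < c ∧ ∀ w, c < w → w < u → Q w + Q u = 2 * Q ((w + u) / 2) := by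
  rcases le_or_gt c 0 with hc0 | hc0
  · refine ⟨Q, fun u hu => ⟨hnonneg u hu, le_rfl⟩, hmono, ?_, ?_, ?_, ?_⟩
    · rw [sub_self]
      exact convexOn_const (0:ℝ) (convex_Ioo (0:ℝ) 1)
    · rw [sub_self]
      exact monotoneOn_const
    · exact fun u hu h => absurd hu.1 (not_lt.2 (h.trans hc0))
    · exact fun u _ h => Or.inl h
  have hcI : c ∈ Ioo (0:ℝ) 1 := ⟨hc0, hc⟩
  obtain ⟨s, hs⟩ := hconv.exists_add_mul_le hcI
  have hs0 : 0 ≤ s := by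
    have h2 : c / 2 ∈ Ioo (0:ℝ) 1 := ⟨by linarith, by linarith⟩
    have h1 := hs _ h2
    have h3 := hmono h2 hcI (by linarith)
    nlinarith
  have hZ := hconv.piecewise_supporting_line hcI hs
  set Z : ℝ → ℝ := fun x => if x ≤ c then Q x else Q c + s * (x - c) with hZdef
  have hZle : ∀ u, u ≤ c → Z u = Q u := fun u hu => if_pos hu
  have hZgt : ∀ u, c < u → Z u = Q c + s * (u - c) := fun u hu => if_neg hu.not_ge
  have hsub : Q - (Q - Z) = Z := sub_sub_cancel Q Z
  have hφ0 : ∀ u ∈ Ioo (0:ℝ) 1, 0 ≤ (Q - Z) u := fun u hu => by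
    rcases le_or_gt u c with h | h
    · simp [hZle u h]
    · simpa [hZgt u h] using hs u hu
  have hφmono : MonotoneOn (Q - Z) (Ioo (0:ℝ) 1) := by
    intro u hu v hv huv
    rcases le_or_gt u c with h | h
    · simpa [hZle u h] using hφ0 v hv
    rcases huv.eq_or_lt with rfl | huv
    · rfl
    have h1 := hconv.slope_mono_adjacent hcI hv h huv
    have h2 : s ≤ (Q u - Q c) / (u - c) := by
      rw [le_div_iff₀ (by linarith)]
      linarith [hs u hu]
    have h3 := h2.trans h1
    rw [le_div_iff₀ (by linarith)] at h3
    simp only [Pi.sub_apply, hZgt u h, hZgt v (h.trans huv)]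
    linarith
  refine ⟨Q - Z, fun u hu => ⟨hφ0 u hu, ?_⟩, hφmono, by rwa [hsub], ?_, ?_, ?_⟩
  · rcases le_or_gt u c with h | h
    · simpa [hZle u h] using hnonneg u hu
    · have := mul_nonneg hs0 (sub_nonneg.2 h.le)
      have := hnonneg c hcI
      simp only [Pi.sub_apply, hZgt u h]
      linarith
  · rw [hsub]
    intro u hu v hv huv
    rcases le_or_gt v c with h | h
    · rw [hZle u (huv.trans h), hZle v h]
      exact hmono hu hv huv
    rw [hZgt v h]
    rcases le_or_gt u c with h' | h'
    · rw [hZle u h']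
      exact (hmono hu hcI h').trans (le_add_of_nonneg_right (mul_nonneg hs0 (by linarith)))
    · rw [hZgt u h']
      gcongr
  · intro u _ h
    simp [hZle u h]
  · intro u hu h
    refine Or.inr ⟨hc0, fun w hcw hwu => ?_⟩
    have hlin : ∀ v, c < v → v ≤ u → Q v = Q c + s * (v - c) := fun v hcv hvu => by
      have hv : v ∈ Ioo (0:ℝ) 1 := ⟨hc0.trans hcv, hvu.trans_lt hu.2⟩
      rw [← hZgt v hcv]
      exact sub_eq_zero.1 (le_antisymm ((hφmono hv hu hvu).trans h.le) (hφ0 v hv))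
    rw [hlin u (hcw.trans hwu) le_rfl, hlin w hcw hwu.le,
      hlin ((w + u) / 2) (by linarith) (by linarith)]
    ring

section FirstOrder

variable {α : Type*} {m : MeasurableSpace α} {ν : Measure α}

theorem integrable_abs_rpow_iff_memLp {p : ℝ} (hp : 0 < p) {f : α → ℝ}
    (hf : AEStronglyMeasurable f ν) :
    Integrable (fun a => |f a| ^ p) ν ↔ MemLp f (ENNReal.ofReal p) ν := by
  have := integrable_norm_rpow_iff hf (ENNReal.ofReal_pos.2 hp).ne' ENNReal.ofReal_ne_top
  rwa [ENNReal.toReal_ofReal hp.le] at this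

theorem integrable_add_const_rpow [IsFiniteMeasure ν] {p : ℝ} (hp : 0 < p) {f : α → ℝ}
    (hf : AEStronglyMeasurable f ν) (hint : Integrable (fun a => |f a| ^ p) ν) (M : ℝ) :
    Integrable (fun a => |f a + M| ^ p) ν :=
  (integrable_abs_rpow_iff_memLp hp (hf.add aestronglyMeasurable_const)).2
    (((integrable_abs_rpow_iff_memLp hp hf).1 hint).add (memLp_const M))

theorem norm_mul_deriv_abs_rpow_le {p : ℝ} (hp : 1 < p) {a y b : ℝ} (ha : 0 ≤ a) (hab : a ≤ b)
    (hy : |y| ≤ b) : ‖a * deriv (fun x : ℝ => |x| ^ p) y‖ ≤ p * |b| ^ p := by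
  have hb := ha.trans hab
  rw [Real.norm_eq_abs, abs_mul, abs_deriv_abs_rpow hp, abs_of_nonneg ha, abs_of_nonneg hb]
  have h1 : |y| ^ (p - 1) ≤ b ^ (p - 1) :=
    Real.rpow_le_rpow (abs_nonneg _) hy (by linarith)
  have h2 : b ^ p = b * b ^ (p - 1) := by
    rcases hb.eq_or_lt with rfl | hb
    · rw [Real.zero_rpow (by linarith), zero_mul]
    · rw [mul_comm, ← Real.rpow_add_one hb.ne']
      simp
  have h3 : a * |y| ^ (p - 1) ≤ b * b ^ (p - 1) := by gcongr
  rw [h2]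
  nlinarith

theorem integrable_mul_deriv_abs_rpow [IsFiniteMeasure ν] {p M : ℝ} (hp : 1 < p) (hM : 0 ≤ M)
    {Q φ Y : α → ℝ} (hQm : AEMeasurable Q ν) (hφm : AEMeasurable φ ν) (hYm : AEMeasurable Y ν)
    (hQ : Integrable (fun a => |Q a| ^ p) ν) (hφ : ∀ᵐ a ∂ν, 0 ≤ φ a ∧ φ a ≤ Q a)
    (hY : ∀ᵐ a ∂ν, |Y a| ≤ Q a + M) :
    Integrable (fun a => φ a * deriv (fun x : ℝ => |x| ^ p) (Y a)) ν := by
  refine ((integrable_add_const_rpow (by linarith) hQm.aestronglyMeasurable hQ M).const_mul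
    p).mono' ?_ ?_
  · exact (hφm.mul ((continuous_deriv_abs_rpow hp).measurable.comp_aemeasurable
      hYm)).aestronglyMeasurable
  · filter_upwards [hφ, hY] with a h1 h2
    exact norm_mul_deriv_abs_rpow_le hp h1.1 (by linarith) h2

/-- First-order optimality condition for an `L^p` projection, along the direction `-φ`. -/
theorem integral_mul_deriv_abs_rpow_nonpos [IsFiniteMeasure ν] {p M : ℝ} (hp : 1 < p)
    {Q R φ : α → ℝ} (hQm : AEMeasurable Q ν) (hRm : AEMeasurable R ν) (hφm : AEMeasurable φ ν)
    (hQ : Integrable (fun a => |Q a| ^ p) ν) (hφ : ∀ᵐ a ∂ν, 0 ≤ φ a ∧ φ a ≤ Q a)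
    (hR : ∀ᵐ a ∂ν, R a ∈ Icc 0 M) (hM : 0 ≤ M)
    (hmin : ∀ t ∈ Ioo (0:ℝ) 1,
      ∫ a, |Q a - R a| ^ p ∂ν ≤ ∫ a, |Q a - t * φ a - R a| ^ p ∂ν) :
    ∫ a, φ a * deriv (fun x : ℝ => |x| ^ p) (Q a - R a) ∂ν ≤ 0 := by
  have hY : ∀ t ∈ Icc (0:ℝ) 1, ∀ᵐ a ∂ν, |Q a - t * φ a - R a| ≤ Q a + M := fun t ht => by
    filter_upwards [hφ, hR] with a h1 h2
    have h3 := mul_nonneg ht.1 h1.1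
    have h4 := mul_le_of_le_one_left h1.1 ht.2
    rw [abs_le]
    constructor <;> linarith [h1.1, h1.2, h2.1, h2.2]
  have hYm : ∀ t : ℝ, AEMeasurable (fun a => Q a - t * φ a - R a) ν := fun t =>
    (hQm.sub (hφm.const_mul t)).sub hRm
  have hbound := integrable_add_const_rpow (ν := ν) (by linarith) hQm.aestronglyMeasurable hQ M
  have hYint : ∀ t ∈ Icc (0:ℝ) 1, Integrable (fun a => |Q a - t * φ a - R a| ^ p) ν :=
    fun t ht => by
      refine hbound.mono' ((continuous_abs.rpow_const
        fun _ => Or.inr (by linarith)).measurable.comp_aemeasurable (hYm t)).aestronglyMeasurable ?_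
      filter_upwards [hY t ht] with a h
      rw [Real.norm_eq_abs, abs_of_nonneg (by positivity)]
      exact Real.rpow_le_rpow (abs_nonneg _) (h.trans (le_abs_self _)) (by linarith)
  have hgint : ∀ t ∈ Icc (0:ℝ) 1, Integrable
      (fun a => φ a * deriv (fun x : ℝ => |x| ^ p) (Q a - t * φ a - R a)) ν := fun t ht =>
    integrable_mul_deriv_abs_rpow hp hM hQm hφm (hYm t) hQ hφ (hY t ht)
  have hneg : ∀ t ∈ Ioo (0:ℝ) 1,
      ∫ a, φ a * deriv (fun x : ℝ => |x| ^ p) (Q a - t * φ a - R a) ∂ν ≤ 0 := fun t ht => by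
    have htI : t ∈ Icc (0:ℝ) 1 := Ioo_subset_Icc_self ht
    have h0 : Integrable (fun a => |Q a - R a| ^ p) ν := by
      simpa using hYint 0 (by simp)
    have h1 : ∫ a, (|Q a - t * φ a - R a| ^ p +
        t * (φ a * deriv (fun x : ℝ => |x| ^ p) (Q a - t * φ a - R a))) ∂ν
        ≤ ∫ a, |Q a - R a| ^ p ∂ν := by
      refine integral_mono ((hYint t htI).add ((hgint t htI).const_mul t)) h0 fun a => ?_
      have := abs_rpow_add_deriv_mul_le hp (Q a - R a) (Q a - t * φ a - R a)
      refine le_trans (le_of_eq ?_) this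
      ring
    rw [integral_add (hYint t htI) ((hgint t htI).const_mul t), integral_const_mul] at h1
    have h2 := hmin t ht
    nlinarith [ht.1]
  have hlim : Tendsto
      (fun t => ∫ a, φ a * deriv (fun x : ℝ => |x| ^ p) (Q a - t * φ a - R a) ∂ν)
      (nhdsWithin 0 (Ioi 0))
      (nhds (∫ a, φ a * deriv (fun x : ℝ => |x| ^ p) (Q a - R a) ∂ν)) := by
    have hev : ∀ᶠ t in nhdsWithin (0:ℝ) (Ioi 0), t ∈ Icc (0:ℝ) 1 :=
      Filter.mem_of_superset (Ioo_mem_nhdsGT one_pos) Ioo_subset_Icc_self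
    refine tendsto_integral_filter_of_dominated_convergence _
      (hev.mono fun t ht => (hgint t ht).aestronglyMeasurable) (hev.mono fun t ht => ?_)
      (hbound.const_mul p) (ae_of_all _ fun a => ?_)
    · filter_upwards [hφ, hY t ht] with a h1 h2
      exact norm_mul_deriv_abs_rpow_le hp h1.1 (by linarith) h2
    · have hcont : Continuous fun t : ℝ =>
          φ a * deriv (fun x : ℝ => |x| ^ p) (Q a - t * φ a - R a) :=
        continuous_const.mul ((continuous_deriv_abs_rpow hp).comp (by fun_prop))
      have := hcont.tendsto 0
      simp only [zero_mul, sub_zero] at this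
      exact this.mono_left nhdsWithin_le_nhds
  exact le_of_tendsto hlim (Filter.eventually_of_mem (Ioo_mem_nhdsGT one_pos) hneg)

end FirstOrder

/-- If the reflected sum of `f` about `c` is non-negative, and positive on a set of positive
measure, then `f` has positive integral. -/
theorem integral_pos_of_reflection {f : ℝ → ℝ} (hf : Integrable f) (c : ℝ)
    (hnonneg : ∀ x, 0 ≤ f x + f (2 * c - x)) {s : Set ℝ} (hs : 0 < volume s)
    (hpos : ∀ x ∈ s, 0 < f x + f (2 * c - x)) : 0 < ∫ x, f x := by
  have hf' : Integrable fun x => f (2 * c - x) := hf.comp_sub_left (2 * c)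
  have h1 : ∫ x, (f x + f (2 * c - x)) = 2 * ∫ x, f x := by
    rw [integral_add hf hf', integral_sub_left_eq_self f volume (2 * c)]
    ring
  have h2 : 0 < ∫ x, (f x + f (2 * c - x)) :=
    (integral_pos_iff_support_of_nonneg hnonneg (hf.add hf')).2
      (hs.trans_le (measure_mono fun x hx => (hpos x hx).ne'))
  linarith

/-- A convex non-decreasing function `Q` on `(0,1)` with `Q c = M` which exceeds `2 * M` has
positive pairing with any perturbation vanishing up to `2 * c - 1`. -/
theorem setIntegral_mul_deriv_abs_rpow_pos {p M c : ℝ} (hp : 1 < p) (hM : 0 < M) {Q φ : ℝ → ℝ}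
    (hconv : ConvexOn ℝ (Ioo (0:ℝ) 1) Q) (hmono : MonotoneOn Q (Ioo (0:ℝ) 1))
    (hnonneg : ∀ u ∈ Ioo (0:ℝ) 1, 0 ≤ Q u) (hc : c ∈ Ioo (0:ℝ) 1) (hQc : Q c = M)
    {b : ℝ} (hb : b ∈ Ioo (0:ℝ) 1) (hQb : 2 * M < Q b)
    (hφ : ∀ u ∈ Ioo (0:ℝ) 1, 0 ≤ φ u) (hφmono : MonotoneOn φ (Ioo (0:ℝ) 1))
    (hφzero : ∀ u ∈ Ioo (0:ℝ) 1, u ≤ 2 * c - 1 → φ u = 0)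
    (hφpos : ∀ u ∈ Ioo (0:ℝ) 1, b < u → 0 < φ u)
    (hint : IntegrableOn (fun u => φ u * deriv (fun x : ℝ => |x| ^ p) (Q u - M)) (Ioo (0:ℝ) 1)) :
    0 < ∫ u in Ioo (0:ℝ) 1, φ u * deriv (fun x : ℝ => |x| ^ p) (Q u - M) := by
  rw [← integral_indicator measurableSet_Ioo]
  set f : ℝ → ℝ := fun u => φ u * deriv (fun x : ℝ => |x| ^ p) (Q u - M) with hf
  have hfpos : ∀ u ∈ Ioo (0:ℝ) 1, c ≤ u → 0 ≤ f u := fun u hu hcu =>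
    mul_nonneg (hφ u hu) (deriv_abs_rpow_nonneg hp (by linarith [hmono hc hu hcu]))
  have hbc : c < b := by
    by_contra! h
    linarith [hmono hb hc h]
  have key : ∀ u ∈ Ioo (0:ℝ) 1, 2 * c - u ∈ Ioo (0:ℝ) 1 → c ≤ u →
      0 ≤ f u + f (2 * c - u) ∧ (b < u → 0 < f u + f (2 * c - u)) := by
    intro u hu hu' hcu
    have hmid : 2 * M ≤ Q u + Q (2 * c - u) := by
      have h := hconv.2 hu hu' (by norm_num : (0:ℝ) ≤ 1 / 2) (by norm_num : (0:ℝ) ≤ 1 / 2)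
        (by norm_num)
      have h2 : (1 / 2 : ℝ) • u + (1 / 2 : ℝ) • (2 * c - u) = c := by
        simp only [smul_eq_mul]
        ring
      rw [h2, hQc] at h
      simp only [smul_eq_mul] at h
      linarith
    have hle := hmono hu' hc (by linarith)
    have hφle := hφmono hu' hu (by linarith)
    have hodd := deriv_abs_rpow_neg hp (M - Q (2 * c - u))
    rw [neg_sub] at hodd
    have h0 := deriv_abs_rpow_nonneg hp (x := M - Q (2 * c - u)) (by linarith)
    have hD := monotone_deriv_abs_rpow hp (show M - Q (2 * c - u) ≤ Q u - M by linarith)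
    have hsplit : f u + f (2 * c - u) =
        φ u * (deriv (fun x : ℝ => |x| ^ p) (Q u - M)
          - deriv (fun x : ℝ => |x| ^ p) (M - Q (2 * c - u)))
        + (φ u - φ (2 * c - u)) * deriv (fun x : ℝ => |x| ^ p) (M - Q (2 * c - u)) := by
      simp only [hf, hodd]
      ring
    rw [hsplit]
    have h1 := mul_nonneg (sub_nonneg.2 hφle) h0
    refine ⟨add_nonneg (mul_nonneg (hφ u hu) (sub_nonneg.2 hD)) h1, fun hbu => ?_⟩
    refine add_pos_of_pos_of_nonneg (mul_pos (hφpos u hu hbu) (sub_pos.2 ?_)) h1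
    refine deriv_abs_rpow_lt hp (by linarith) ?_
    linarith [hmono hb hu hbu.le, hnonneg _ hu']
  have hge : ∀ x, c ≤ x → 0 ≤ (Ioo (0:ℝ) 1).indicator f x
      + (Ioo (0:ℝ) 1).indicator f (2 * c - x) := by
    intro x hx
    by_cases h1 : x ∈ Ioo (0:ℝ) 1 <;> by_cases h2 : 2 * c - x ∈ Ioo (0:ℝ) 1
    · simpa [h1, h2] using (key x h1 h2 hx).1
    · simpa [h1, h2] using hfpos x h1 hx
    · have hx1 : 1 ≤ x := by
        by_contra! h
        exact h1 ⟨hc.1.trans_le hx, h⟩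
      simp [h1, h2, hf, hφzero _ h2 (by linarith)]
    · simp [h1, h2]
  refine integral_pos_of_reflection (s := Ioo b 1)
    ((integrable_indicator_iff measurableSet_Ioo).2 hint) c (fun x => ?_) (by simpa using hb.2) ?_
  · rcases le_total c x with h | h
    · exact hge x h
    · have := hge (2 * c - x) (by linarith)
      rw [sub_sub_cancel] at this
      linarith
  · rintro x ⟨hbx, hx1⟩
    have h1 : x ∈ Ioo (0:ℝ) 1 := ⟨hb.1.trans hbx, hx1⟩
    by_cases h2 : 2 * c - x ∈ Ioo (0:ℝ) 1
    · simpa [h1, h2] using (key x h1 h2 (by linarith)).2 hbx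
    · simp only [h1, h2, indicator_of_mem, indicator_of_notMem, not_false_eq_true, add_zero]
      exact mul_pos (hφpos x h1 hbx) <| (deriv_abs_rpow_nonneg hp le_rfl).trans_lt
        (deriv_abs_rpow_lt hp le_rfl (by linarith [hmono hb h1 hbx.le]))

theorem integral_le_of_Wdist_le {p : ℝ} (hp : 0 < p) {μ ν σ : Measure ℝ}
    (h : Wdist p μ σ ≤ Wdist p ν σ) :
    ∫ u in Ioo (0:ℝ) 1, |quantile μ u - quantile σ u| ^ p
      ≤ ∫ u in Ioo (0:ℝ) 1, |quantile ν u - quantile σ u| ^ p :=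
  (Real.rpow_le_rpow_iff (integral_nonneg fun _ => by positivity)
    (integral_nonneg fun _ => by positivity) (by positivity)).1 h

/-- Proposition 3.4(ii). Let `p > 1` and let `μ ∈ P_p([0,∞))` be
supported on `[0, M]` for some `M > 0`. Then the Wasserstein projection of `μ` onto
`F_{m,p}` is supported on `[0, 2M]`; in particular it is compactly supported. -/
theorem wasserstein_projection_monotone_compact_support
    (p : ℝ) (hp : 1 < p)
    (μ : MeasureTheory.Measure ℝ) (hμ : HasFiniteMomentP p μ)
    (M : ℝ) (hM : 0 < M)
    (hsupp : μ (Set.Icc (0:ℝ) M)ᶜ = 0)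
    (μhat : MeasureTheory.Measure ℝ)
    (hμhatF : μhat ∈ Fmp p)
    (hμhatmin : ∀ ν ∈ Fmp p, Wdist p μhat μ ≤ Wdist p ν μ) :
    μhat (Set.Icc (0:ℝ) (2 * M))ᶜ = 0 := by
  have := hμ.1
  obtain ⟨hmom, hneg, hconv, hmono, hzero⟩ := hμhatF
  have := hmom.1
  set Q := quantile μhat with hQdef
  set R := quantile μ with hRdef
  have hnonneg : ∀ u ∈ Ioo (0:ℝ) 1, 0 ≤ Q u := fun u hu => by
    by_contra! h
    have h1 := (quantile_le_iff μhat hu _).1 (le_refl (quantile μhat u))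
    rw [measure_mono_null (Iic_subset_Iio.2 h) hneg] at h1
    exact absurd h1 (not_le.2 hu.1)
  have hR : ∀ u ∈ Ioo (0:ℝ) 1, R u ∈ Icc 0 M := fun u hu => quantile_mem_Icc hsupp hu
  suffices hle : ∀ u ∈ Ioo (0:ℝ) 1, Q u ≤ 2 * M by
    rw [← map_quantile μhat, Measure.map_apply_of_aemeasurable (aemeasurable_quantile μhat)
      measurableSet_Icc.compl, Measure.restrict_apply' measurableSet_Ioo]
    convert measure_empty (μ := (volume : Measure ℝ))
    exact eq_empty_of_forall_notMem fun u hu => hu.1 ⟨hnonneg u hu.2, hle u hu.2⟩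
  by_contra! hex
  obtain ⟨b, hb, hQb⟩ := hex
  obtain ⟨c, hc, hQc⟩ : ∃ c ∈ Ioo (0:ℝ) 1, Q c = M := by
    obtain ⟨a, ha, haM⟩ := ((show ∀ᶠ a in nhdsWithin (0:ℝ) (Ioi 0), a ∈ Ioo 0 b from
      Ioo_mem_nhdsGT hb.1).and (hzero.eventually_lt_const hM)).exists
    have haI : a ∈ Ioo (0:ℝ) 1 := ⟨ha.1, ha.2.trans hb.2⟩
    have hsub : Icc a b ⊆ Ioo (0:ℝ) 1 := Icc_subset_Ioo haI.1 hb.2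
    obtain ⟨c, hc, hQc⟩ := intermediate_value_Icc ha.2.le
      ((hconv.continuousOn isOpen_Ioo).mono hsub) (show M ∈ Icc (Q a) (Q b) from
        ⟨haM.le, by linarith⟩)
    exact ⟨c, hsub hc, hQc⟩
  have hcb : c < b := by
    by_contra! h
    linarith [hmono hb hc h]
  obtain ⟨φ, hφ, hφmono, hZconv, hZmono, hφzero, hφflat⟩ :=
    exists_hinge_perturbation hconv hmono hnonneg (show 2 * c - 1 < 1 by linarith [hc.2])
  have hφpos : ∀ u ∈ Ioo (0:ℝ) 1, b < u → 0 < φ u := by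
    intro u hu hbu
    refine (hφ u hu).1.lt_of_ne fun h => ?_
    have hQu := hmono hb hu hbu.le
    rcases hφflat u hu h.symm with h0 | ⟨hc0, hmid⟩
    · linarith
    · have h1 := hmid (2 * c - u) (by linarith [hu.2]) (by linarith)
      rw [sub_add_cancel, mul_div_cancel_left₀ c two_ne_zero, hQc] at h1
      have h2 := hnonneg (2 * c - u) ⟨by linarith [hu.2], by linarith [hc.2]⟩
      linarith
  have hφm : AEMeasurable φ (volume.restrict (Ioo (0:ℝ) 1)) :=
    aemeasurable_restrict_of_monotoneOn measurableSet_Ioo hφmono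
  have hQm : AEMeasurable Q (volume.restrict (Ioo (0:ℝ) 1)) := aemeasurable_quantile μhat
  have hRm : AEMeasurable R (volume.restrict (Ioo (0:ℝ) 1)) := aemeasurable_quantile μ
  have hQint : IntegrableOn (fun u => |Q u| ^ p) (Ioo (0:ℝ) 1) := integrableOn_quantile_rpow hmom
  have hφae : ∀ᵐ u ∂volume.restrict (Ioo (0:ℝ) 1), 0 ≤ φ u ∧ φ u ≤ Q u :=
    ae_restrict_of_forall_mem measurableSet_Ioo hφ
  have hRae : ∀ᵐ u ∂volume.restrict (Ioo (0:ℝ) 1), R u ∈ Icc 0 M :=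
    ae_restrict_of_forall_mem measurableSet_Ioo hR
  have hopt : ∫ u in Ioo (0:ℝ) 1, φ u * deriv (fun x : ℝ => |x| ^ p) (Q u - R u) ≤ 0 := by
    refine integral_mul_deriv_abs_rpow_nonpos hp hQm hRm hφm hQint hφae hRae hM.le
      fun t ht => ?_
    have heq : (fun u => Q u - t * φ u) = fun u => (1 - t) * Q u + t * (Q - φ) u := by
      ext u
      simp only [Pi.sub_apply]
      ring
    have ht' : 0 ≤ 1 - t := by linarith [ht.2]
    have hbd : ∀ u ∈ Ioo (0:ℝ) 1, 0 ≤ Q u - t * φ u ∧ Q u - t * φ u ≤ Q u := fun u hu => by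
      have h1 := mul_nonneg ht.1.le (hφ u hu).1
      have h2 := mul_le_of_le_one_left (hφ u hu).1 ht.2.le
      constructor <;> linarith [(hφ u hu).2]
    have hev : ∀ᶠ u in nhdsWithin (0:ℝ) (Ioi 0), u ∈ Ioo (0:ℝ) 1 := Ioo_mem_nhdsGT one_pos
    obtain ⟨σ, hσ, hσq⟩ := exists_mem_Fmp_quantile_eq (p := p) (by linarith)
      (G := fun u => Q u - t * φ u)
      (by rw [heq]; exact (hconv.smul ht').add (hZconv.smul ht.1.le))
      (by
        rw [heq]
        intro u hu v hv huv
        have h1 := mul_le_mul_of_nonneg_left (hmono hu hv huv) ht'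
        have h2 := mul_le_mul_of_nonneg_left (hZmono hu hv huv) ht.1.le
        exact add_le_add h1 h2)
      (fun u hu => (hbd u hu).1)
      (tendsto_of_tendsto_of_tendsto_of_le_of_le' tendsto_const_nhds hzero
        (hev.mono fun u hu => (hbd u hu).1) (hev.mono fun u hu => (hbd u hu).2))
      (by
        refine hQint.mono' ((continuous_abs.rpow_const
          fun _ => Or.inr (by linarith)).measurable.comp_aemeasurable
            (hQm.sub (hφm.const_mul t))).aestronglyMeasurable
          (ae_restrict_of_forall_mem measurableSet_Ioo fun u hu => ?_)
        rw [Real.norm_eq_abs, abs_of_nonneg (by positivity), abs_of_nonneg (hbd u hu).1,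
          abs_of_nonneg (hnonneg u hu)]
        exact Real.rpow_le_rpow (hbd u hu).1 (hbd u hu).2 (by linarith))
    refine (integral_le_of_Wdist_le (by linarith) (hμhatmin σ hσ)).trans_eq ?_
    exact setIntegral_congr_fun measurableSet_Ioo fun u hu => by simp only [hσq u hu, hRdef]
  have hint : ∀ S : ℝ → ℝ, AEMeasurable S (volume.restrict (Ioo (0:ℝ) 1)) →
      (∀ u ∈ Ioo (0:ℝ) 1, S u ∈ Icc 0 M) →
      IntegrableOn (fun u => φ u * deriv (fun x : ℝ => |x| ^ p) (Q u - S u)) (Ioo (0:ℝ) 1) :=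
    fun S hSm hS => integrable_mul_deriv_abs_rpow hp hM.le hQm hφm (hQm.sub hSm) hQint hφae
      (ae_restrict_of_forall_mem measurableSet_Ioo fun u hu => by
        have := hnonneg u hu
        rw [abs_le]
        constructor <;> linarith [(hS u hu).1, (hS u hu).2])
  have hintM := hint (fun _ => M) aemeasurable_const fun _ _ => ⟨hM.le, le_rfl⟩
  refine absurd ((setIntegral_mul_deriv_abs_rpow_pos hp hM hconv hmono hnonneg hc hQc hb hQb
    (fun u hu => (hφ u hu).1) hφmono hφzero hφpos hintM).trans_le ?_) (not_lt.2 hopt)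
  exact setIntegral_mono_on hintM (hint R hRm hR) measurableSet_Ioo fun u hu =>
    mul_le_mul_of_nonneg_left (monotone_deriv_abs_rpow hp (by linarith [(hR u hu).2])) (hφ u hu).1
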